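/- (Theorem 5.) Assume each ṽ_j ≠ 0 and each w̃_j ≠ 0, let D̃_v and D̃_w be the r×r diagonal matrices with diagonal entries 1/‖ṽ_j‖ and 1/‖w̃_j‖ respectively, and assume σmin(Ṽ * D̃_v) > 0 and σmin(W̃ * D̃_w) > 0. Then the Frobenius norm of the backward perturbation satisfies ‖F₂ᵣ‖_F ≤ Real.sqrt r · ‖Φ̃‖ · ( (max over j of ‖η_j‖/‖ṽ_j‖) / σmin(Ṽ * D̃_v) + (max over j of ‖ξ_j‖/‖w̃_j‖) / σmin(W̃ * D̃_w) ). -/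

import Mathlib

open Matrix

/-- Euclidean norm of a vector. -/
noncomputable def vnorm {k : ℕ} (x : Fin k → ℂ) : ℝ :=
  ‖(WithLp.equiv 2 (Fin k → ℂ)).symm x‖

/-- Spectral (Euclidean operator) norm of a matrix. -/
noncomputable def mnorm {k l : ℕ} (M : Matrix (Fin k) (Fin l) ℂ) : ℝ :=
  ‖LinearMap.toContinuousLinearMap (Matrix.toEuclideanLin M)‖

/-- Frobenius norm of a matrix. -/
noncomputable def fnorm {k l : ℕ} (M : Matrix (Fin k) (Fin l) ℂ) : ℝ :=
  Real.sqrt (∑ i, ∑ j, ‖M i j‖ ^ 2)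

/-- Smallest singular value of a matrix. -/
noncomputable def smin {k l : ℕ} (M : Matrix (Fin k) (Fin l) ℂ) : ℝ :=
  sInf {t : ℝ | ∃ x : Fin l → ℂ, vnorm x = 1 ∧ t = vnorm (M *ᵥ x)}

lemma vnorm_sq {k : ℕ} (x : Fin k → ℂ) : vnorm x ^ 2 = ∑ i, ‖x i‖ ^ 2 := by
  simp [vnorm, EuclideanSpace.norm_sq_eq]

lemma vnorm_nonneg {k : ℕ} (x : Fin k → ℂ) : 0 ≤ vnorm x := norm_nonneg _

lemma vnorm_smul {k : ℕ} (a : ℂ) (x : Fin k → ℂ) : vnorm (a • x) = ‖a‖ * vnorm x := by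
  simp [vnorm, norm_smul]

lemma vnorm_pos {k : ℕ} {x : Fin k → ℂ} (hx : x ≠ 0) : 0 < vnorm x := by
  simpa [vnorm] using hx

lemma vnorm_star {k : ℕ} (x : Fin k → ℂ) : vnorm (star x) = vnorm x := by
  rw [← sq_eq_sq₀ (vnorm_nonneg _) (vnorm_nonneg _), vnorm_sq, vnorm_sq]
  simp

lemma mnorm_nonneg {k l : ℕ} (M : Matrix (Fin k) (Fin l) ℂ) : 0 ≤ mnorm M := norm_nonneg _

lemma vnorm_mulVec_le {k l : ℕ} (M : Matrix (Fin k) (Fin l) ℂ) (x : Fin l → ℂ) :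
    vnorm (M *ᵥ x) ≤ mnorm M * vnorm x :=
  (LinearMap.toContinuousLinearMap (Matrix.toEuclideanLin M)).le_opNorm (WithLp.toLp 2 x)

lemma mnorm_le {k l : ℕ} (M : Matrix (Fin k) (Fin l) ℂ) {c : ℝ} (hc : 0 ≤ c)
    (h : ∀ x, vnorm (M *ᵥ x) ≤ c * vnorm x) : mnorm M ≤ c :=
  ContinuousLinearMap.opNorm_le_bound _ hc fun x => h x.ofLp

open scoped Matrix.Norms.L2Operator in
lemma mnorm_conjTranspose {k l : ℕ} (M : Matrix (Fin k) (Fin l) ℂ) : mnorm Mᴴ = mnorm M :=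
  Matrix.l2_opNorm_conjTranspose M

lemma mnorm_transpose {k l : ℕ} (M : Matrix (Fin k) (Fin l) ℂ) : mnorm Mᵀ = mnorm M := by
  have key : ∀ {k l : ℕ} (M : Matrix (Fin k) (Fin l) ℂ), mnorm Mᵀ ≤ mnorm M := fun M => by
    refine mnorm_le _ (mnorm_nonneg _) fun x => ?_
    have h : Mᵀ *ᵥ x = star (Mᴴ *ᵥ star x) := by
      rw [Matrix.star_mulVec, Matrix.conjTranspose_conjTranspose, star_star,
        Matrix.mulVec_transpose]
    rw [h, vnorm_star, ← mnorm_conjTranspose M, ← vnorm_star x]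
    exact vnorm_mulVec_le _ _
  exact (key M).antisymm (by simpa using key Mᵀ)

lemma smin_mul_vnorm_le {k l : ℕ} (M : Matrix (Fin k) (Fin l) ℂ) (x : Fin l → ℂ) :
    smin M * vnorm x ≤ vnorm (M *ᵥ x) := by
  rcases eq_or_ne x 0 with rfl | hx
  · simp [vnorm]
  · have hpos := vnorm_pos hx
    rw [← le_div_iff₀ hpos]
    refine csInf_le ⟨0, ?_⟩ ⟨((vnorm x)⁻¹ : ℝ) • x, ?_, ?_⟩
    · rintro _ ⟨y, -, rfl⟩
      exact vnorm_nonneg _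
    · rw [← Complex.coe_smul, vnorm_smul, Complex.norm_real, Real.norm_of_nonneg (by positivity),
        inv_mul_cancel₀ hpos.ne']
    · rw [← Complex.coe_smul, Matrix.mulVec_smul, vnorm_smul, Complex.norm_real,
        Real.norm_of_nonneg (by positivity), div_eq_inv_mul]

lemma mnorm_le_div_smin {k l q : ℕ} (A : Matrix (Fin k) (Fin l) ℂ) (Y : Matrix (Fin l) (Fin q) ℂ)
    (hA : 0 < smin A) : mnorm Y ≤ mnorm (A * Y) / smin A := by
  refine mnorm_le _ (div_nonneg (mnorm_nonneg _) hA.le) fun x => ?_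
  rw [div_mul_eq_mul_div, le_div_iff₀ hA, mul_comm]
  refine (smin_mul_vnorm_le A _).trans ?_
  rw [Matrix.mulVec_mulVec]
  exact vnorm_mulVec_le _ _

lemma fnorm_nonneg {k l : ℕ} (M : Matrix (Fin k) (Fin l) ℂ) : 0 ≤ fnorm M := Real.sqrt_nonneg _

lemma fnorm_transpose {k l : ℕ} (M : Matrix (Fin k) (Fin l) ℂ) : fnorm Mᵀ = fnorm M := by
  simp only [fnorm, Matrix.transpose_apply]
  rw [Finset.sum_comm]

lemma fnorm_sq {k l : ℕ} (M : Matrix (Fin k) (Fin l) ℂ) :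
    fnorm M ^ 2 = ∑ j, vnorm (M.col j) ^ 2 := by
  rw [← fnorm_transpose, fnorm, Real.sq_sqrt (by positivity)]
  simp [vnorm_sq]

open scoped Matrix.Norms.Frobenius in
lemma fnorm_add_le {k l : ℕ} (M N : Matrix (Fin k) (Fin l) ℂ) :
    fnorm (M + N) ≤ fnorm M + fnorm N := by
  have h : ∀ A : Matrix (Fin k) (Fin l) ℂ, fnorm A = ‖A‖ := fun A => by
    simp [fnorm, Matrix.frobenius_norm_def, Real.sqrt_eq_rpow]
  simpa only [h] using norm_add_le M N

lemma fnorm_mul_le_mnorm_mul_fnorm {k l q : ℕ} (A : Matrix (Fin k) (Fin l) ℂ)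
    (B : Matrix (Fin l) (Fin q) ℂ) : fnorm (A * B) ≤ mnorm A * fnorm B := by
  refine (sq_le_sq₀ (fnorm_nonneg _) (mul_nonneg (mnorm_nonneg _) (fnorm_nonneg _))).1 ?_
  rw [mul_pow, fnorm_sq, fnorm_sq, Finset.mul_sum]
  refine Finset.sum_le_sum fun j _ => ?_
  rw [← mul_pow]
  exact pow_le_pow_left₀ (vnorm_nonneg _) (vnorm_mulVec_le A (B.col j)) 2

lemma fnorm_mul_le_fnorm_mul_mnorm {k l q : ℕ} (A : Matrix (Fin k) (Fin l) ℂ)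
    (B : Matrix (Fin l) (Fin q) ℂ) : fnorm (A * B) ≤ fnorm A * mnorm B := by
  rw [← fnorm_transpose, Matrix.transpose_mul, ← fnorm_transpose A, ← mnorm_transpose B, mul_comm]
  exact fnorm_mul_le_mnorm_mul_fnorm _ _

lemma fnorm_le_sqrt_mul {k l : ℕ} (M : Matrix (Fin k) (Fin l) ℂ) {c : ℝ} (hc : 0 ≤ c)
    (h : ∀ j, vnorm (M.col j) ≤ c) : fnorm M ≤ Real.sqrt l * c := by
  refine (sq_le_sq₀ (fnorm_nonneg _) (by positivity)).1 ?_
  rw [mul_pow, Real.sq_sqrt (Nat.cast_nonneg l), fnorm_sq]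
  refine (Finset.sum_le_sum fun j _ => pow_le_pow_left₀ (vnorm_nonneg _) (h j) 2).trans ?_
  simp

/-- Column scaling of the two factors gives the bound for one half of the perturbation. -/
lemma fnorm_mul_le_of_scaled_columns {n q r : ℕ} (v e : Fin r → Fin n → ℂ)
    (V R : Matrix (Fin n) (Fin r) ℂ) (Y : Matrix (Fin r) (Fin q) ℂ)
    (hR : ∀ j i, R i j = e j i) (hv : ∀ j, v j ≠ 0)
    (D : Matrix (Fin r) (Fin r) ℂ)
    (hD : D = Matrix.diagonal fun j => (((vnorm (v j))⁻¹ : ℝ) : ℂ))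
    (hsmin : 0 < smin (V * D)) :
    fnorm (R * Y) ≤
      Real.sqrt r * mnorm (V * Y) * ((⨆ j, vnorm (e j) / vnorm (v j)) / smin (V * D)) := by
  have hunit : IsUnit D.det := by
    rw [hD, Matrix.det_diagonal, isUnit_iff_ne_zero, Finset.prod_ne_zero_iff]
    intro j _
    exact_mod_cast inv_ne_zero (vnorm_pos (hv j)).ne'
  have hcancel : ∀ A : Matrix (Fin n) (Fin r) ℂ, A * D * (D⁻¹ * Y) = A * Y := fun A => by
    rw [Matrix.mul_assoc, Matrix.mul_nonsing_inv_cancel_left _ _ hunit]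
  have hnonneg : 0 ≤ ⨆ j, vnorm (e j) / vnorm (v j) :=
    Real.iSup_nonneg fun j => div_nonneg (vnorm_nonneg _) (vnorm_nonneg _)
  have hRD : fnorm (R * D) ≤ Real.sqrt r * ⨆ j, vnorm (e j) / vnorm (v j) := by
    refine fnorm_le_sqrt_mul _ hnonneg fun j => ?_
    have hcol : (R * D).col j = (((vnorm (v j))⁻¹ : ℝ) : ℂ) • e j := by
      ext i
      simp [hD, Matrix.mul_diagonal, hR, mul_comm]
    rw [hcol, vnorm_smul, Complex.norm_real,
      Real.norm_of_nonneg (inv_nonneg.2 (vnorm_nonneg _)), ← div_eq_inv_mul]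
    exact le_ciSup (f := fun j => vnorm (e j) / vnorm (v j)) (Set.finite_range _).bddAbove j
  have hY := mnorm_le_div_smin (V * D) (D⁻¹ * Y) hsmin
  rw [hcancel] at hY
  calc fnorm (R * Y) = fnorm (R * D * (D⁻¹ * Y)) := by rw [hcancel]
    _ ≤ fnorm (R * D) * mnorm (D⁻¹ * Y) := fnorm_mul_le_fnorm_mul_mnorm _ _
    _ ≤ (Real.sqrt r * ⨆ j, vnorm (e j) / vnorm (v j)) * (mnorm (V * Y) / smin (V * D)) :=
      mul_le_mul hRD hY (mnorm_nonneg _) (by positivity)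
    _ = _ := by ring

/-- Theorem 5: Frobenius-norm bound on the backward perturbation `F₂ᵣ`. -/
theorem backward_perturbation_frobenius_bound
    {n m p r : ℕ} [NeZero r] (hn : 0 < n) (hm : 0 < m) (hp : 0 < p)
    (K : ℂ → Matrix (Fin n) (Fin n) ℂ)
    (B : ℂ → Matrix (Fin n) (Fin m) ℂ)
    (C : ℂ → Matrix (Fin p) (Fin n) ℂ)
    (σ : Fin r → ℂ)
    (b : Fin r → Fin m → ℂ) (c : Fin r → Fin p → ℂ)
    (vt wt : Fin r → Fin n → ℂ)
    (η ξ : Fin r → Fin n → ℂ)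
    (hη : ∀ j, η j = K (σ j) *ᵥ vt j - B (σ j) *ᵥ b j)
    (hξ : ∀ j, ξ j = (K (σ j))ᵀ *ᵥ wt j - (C (σ j))ᵀ *ᵥ c j)
    (Vt Wt Rb Rc : Matrix (Fin n) (Fin r) ℂ)
    (hVt : ∀ j i, Vt i j = vt j i) (hWt : ∀ j i, Wt i j = wt j i)
    (hRb : ∀ j i, Rb i j = η j i) (hRc : ∀ j i, Rc i j = ξ j i)
    (hinv : IsUnit (Wtᵀ * Vt))
    (Phi : Matrix (Fin n) (Fin n) ℂ)
    (hPhi : Phi = Vt * (Wtᵀ * Vt)⁻¹ * Wtᵀ)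
    (F : Matrix (Fin n) (Fin n) ℂ)
    (hF : F = Rb * (Wtᵀ * Vt)⁻¹ * Wtᵀ + Vt * (Wtᵀ * Vt)⁻¹ * Rcᵀ)
    (hvt : ∀ j, vt j ≠ 0) (hwt : ∀ j, wt j ≠ 0)
    (Dv Dw : Matrix (Fin r) (Fin r) ℂ)
    (hDv : Dv = Matrix.diagonal fun j => (((vnorm (vt j))⁻¹ : ℝ) : ℂ))
    (hDw : Dw = Matrix.diagonal fun j => (((vnorm (wt j))⁻¹ : ℝ) : ℂ))
    (hsminV : 0 < smin (Vt * Dv)) (hsminW : 0 < smin (Wt * Dw)) :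
    fnorm F ≤ Real.sqrt r * mnorm Phi *
      ((⨆ j, vnorm (η j) / vnorm (vt j)) / smin (Vt * Dv) +
        (⨆ j, vnorm (ξ j) / vnorm (wt j)) / smin (Wt * Dw)) := by
  rw [hF, mul_add]
  refine (fnorm_add_le _ _).trans (add_le_add ?_ ?_)
  · have h := fnorm_mul_le_of_scaled_columns vt η Vt Rb ((Wtᵀ * Vt)⁻¹ * Wtᵀ) hRb hvt Dv hDv hsminV
    rwa [← Matrix.mul_assoc, ← Matrix.mul_assoc, ← hPhi] at h
  · have h := fnorm_mul_le_of_scaled_columns wt ξ Wt Rc (Vt * (Wtᵀ * Vt)⁻¹)ᵀ hRc hwt Dw hDw hsminW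
    rwa [← fnorm_transpose, ← mnorm_transpose, Matrix.transpose_mul, Matrix.transpose_mul Wt,
      Matrix.transpose_transpose, ← hPhi] at h
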